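/- Two locally convex broken lines with integer vertices (respectively, two convex polygons with integer vertices) are integer congruent if and only if their angle-curvature sequences coincide (corresponding angles are integer congruent and corresponding chord curvatures are equal) and their sequences of integer lengths of edges coincide. -/

import Mathlib

open scoped BigOperators

/-- Integer points of the plane. -/
abbrev Pt := ℤ × ℤ

/-- Determinant of two integer vectors. -/
def vdet (u v : Pt) : ℤ := u.1 * v.2 - u.2 * v.1

/-- Integer length of the segment `PQ`. -/
def il (P Q : Pt) : ℤ := Int.gcd (Q.1 - P.1) (Q.2 - P.2)

/-- Integer distance from the point `P` to the line through `S` and `T`. -/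
def idist (P S T : Pt) : ℤ := |vdet (T - S) (P - S)| / il S T

/-- The primitive integer vector in the direction from `P` to `Q`. -/
def primVec (P Q : Pt) : Pt := ((Q.1 - P.1) / il P Q, (Q.2 - P.2) / il P Q)

/-- `Q` lies on the ray emanating from `V` through `X`. -/
def OnRay (V X Q : Pt) : Prop := ∃ s t : ℤ, 0 < s ∧ 0 < t ∧ s • (Q - V) = t • (X - V)

/-- `P` lies in the convex angle with vertex `V` and edge rays towards `X` and `Y`. -/
def InAngle (X V Y P : Pt) : Prop :=
  ∃ q s t : ℤ, 0 < q ∧ 0 ≤ s ∧ 0 ≤ t ∧ q • (P - V) = s • (X - V) + t • (Y - V)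

/-- An affine lattice-preserving transformation of `ℤ²` (an element of Aff(2,ℤ)). -/
structure IntAff where
  a : ℤ
  b : ℤ
  c : ℤ
  d : ℤ
  u : ℤ
  v : ℤ
  unimod : a * d - b * c = 1 ∨ a * d - b * c = -1

/-- Action of an element of Aff(2,ℤ) on an integer point. -/
def IntAff.apply (T : IntAff) (P : Pt) : Pt :=
  (T.a * P.1 + T.b * P.2 + T.u, T.c * P.1 + T.d * P.2 + T.v)

/-- Integer congruence of the angles ∠XVY and ∠X'V'Y' (vertices `V`, `V'`). -/
def AngleCong (X V Y X' V' Y' : Pt) : Prop :=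
  ∃ T : IntAff, T.apply V = V' ∧ OnRay V' X' (T.apply X) ∧ OnRay V' Y' (T.apply Y)

/-- Auxiliary function: continuant of the reversed list. -/
def contRev : List ℤ → ℤ
  | [] => 1
  | [x] => x
  | x :: y :: l => x * contRev (y :: l) + contRev l

/-- The continuant `K`: `K(ε)=1`, `K(x₁)=x₁`,
`K(x₁,…,xₙ)=xₙK(x₁,…,x_{n−1})+K(x₁,…,x_{n−2})`. -/
def cont (l : List ℤ) : ℤ := contRev l.reverse

/-- A list is a valid LLS sequence of a rational integer angle:
odd length and positive entries. -/
def ValidLLS (l : List ℤ) : Prop := l.length % 2 = 1 ∧ ∀ x ∈ l, 0 < x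

/-- The second edge point of the standard angle ∠(a₀,…,a₂ₘ):
the point `(K(a₁,…,a₂ₘ), K(a₀,…,a₂ₘ))`. -/
def stdPt (l : List ℤ) : Pt := (cont l.tail, cont l)

/-- The angle ∠XVY (vertex `V`) is a rational angle with LLS sequence `l`;
equivalently it is integer congruent to the standard angle
∠((1,0),(0,0),(K(a₁,…,a₂ₘ),K(a₀,…,a₂ₘ))) of the list. -/
def IsLLSOfAngle (X V Y : Pt) (l : List ℤ) : Prop :=
  ValidLLS l ∧ AngleCong ((1, 0) : Pt) ((0, 0) : Pt) (stdPt l) X V Y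

open Classical in
/-- Direction comparison sign `sgn⟨u,w⟩`: `1` if `w` has the same direction as `u`,
`0` if `w = 0`, and `-1` otherwise. -/
noncomputable def sgnDir (u w : Pt) : ℤ :=
  if w = ((0 : ℤ), (0 : ℤ)) then 0
  else if ∃ s t : ℤ, 0 < s ∧ 0 < t ∧ s • w = t • u then 1 else -1

/-- `P` is the integer point of the angle ∠XVY at integer distance 1 from the
line `VY` which is closest to the line `XV`. -/
def IsNearPt (X V Y P : Pt) : Prop :=
  InAngle X V Y P ∧ idist P V Y = 1 ∧
  ∀ Q : Pt, InAngle X V Y Q → idist Q V Y = 1 → idist P X V ≤ idist Q X V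

/-- `k` is the chord curvature of the locally convex broken line `ABCD`. -/
def IsChordCurv (A B C D : Pt) (k : ℤ) : Prop :=
  ∃ B' C' : Pt, IsNearPt A B C B' ∧ IsNearPt D C B C' ∧
    k = il B C - sgnDir (C - B) (C' - B') * il B' C' - 2

/-- `A` lists the vertices of a convex polygon (in convex position, ordered so that
all interior angles are positively oriented). -/
def ConvexPolygon (n : ℕ) (A : ZMod n → Pt) : Prop :=
  ∀ i j : ZMod n, j ≠ i → j ≠ i + 1 → vdet (A (i + 1) - A i) (A j - A i) < 0

/-- A closed broken line (polygon) all of whose angles have the same orientation. -/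
def LocallyConvexPolygon (n : ℕ) (A : ZMod n → Pt) : Prop :=
  (∀ i : ZMod n, 0 < vdet (A (i - 1) - A i) (A (i + 1) - A i)) ∨
  (∀ i : ZMod n, vdet (A (i - 1) - A i) (A (i + 1) - A i) < 0)

/-- A locally convex closed polygon with positively oriented angles. -/
def PosLocConvexPolygon (n : ℕ) (A : ZMod n → Pt) : Prop :=
  ∀ i : ZMod n, 0 < vdet (A (i - 1) - A i) (A (i + 1) - A i)

/-- A locally convex broken line `A 0 … A (n+1)` (angles at vertices `1,…,n`). -/
def LocallyConvexBL (n : ℕ) (A : ℕ → Pt) : Prop :=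
  (∀ i, 1 ≤ i → i ≤ n → 0 < vdet (A (i - 1) - A i) (A (i + 1) - A i)) ∨
  (∀ i, 1 ≤ i → i ≤ n → vdet (A (i - 1) - A i) (A (i + 1) - A i) < 0)

/-- A locally convex broken line with positively oriented angles. -/
def PosLocConvexBL (n : ℕ) (A : ℕ → Pt) : Prop :=
  ∀ i, 1 ≤ i → i ≤ n → 0 < vdet (A (i - 1) - A i) (A (i + 1) - A i)

/-- The polygon `A` (with `n` vertices) has angle-curvature sequence
`(L 0, κ 0, …, L (n-1), κ (n-1))` (0-indexed). -/
def HasACS (n : ℕ) (A : ZMod n → Pt) (L : ℕ → List ℤ) (κ : ℕ → ℤ) : Prop :=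
  ∀ i : ℕ, i < n →
    IsLLSOfAngle (A ((i : ZMod n) - 1)) (A (i : ZMod n)) (A ((i : ZMod n) + 1)) (L i) ∧
    IsChordCurv (A ((i : ZMod n) - 1)) (A (i : ZMod n)) (A ((i : ZMod n) + 1))
      (A ((i : ZMod n) + 2)) (κ i)

/-- `llsCat L κ j m = lls(S_j^{j+m})`, the concatenation
`lls(α_j) ∘ (κ_j) ∘ ⋯ ∘ (κ_{j+m-1}) ∘ lls(α_{j+m})` (0-indexed angles). -/
def llsCat (L : ℕ → List ℤ) (κ : ℕ → ℤ) (j : ℕ) : ℕ → List ℤ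
  | 0 => L j
  | m + 1 => llsCat L κ j m ++ (κ (j + m) :: L (j + m + 1))

/-- Number of consecutive opposite-sign pairs. -/
def altCount : List ℤ → ℕ
  | x :: y :: l => (if x * y < 0 then 1 else 0) + altCount (y :: l)
  | _ => 0

/-- Number of sign changes of an integer sequence: after removing all zero
elements, the number of pairs of consecutive elements with opposite signs. -/
def signChanges (l : List ℤ) : ℕ := altCount (l.filter (fun x => x != 0))

/-- Coercion of an integer point to the real plane. -/
noncomputable def toR (P : Pt) : ℝ × ℝ := ((P.1 : ℝ), (P.2 : ℝ))

/-- The integer points of the angle ∠XVY distinct from the vertex. -/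
def conePts (X V Y : Pt) : Set Pt := {P | InAngle X V Y P ∧ P ≠ V}

/-- `P` is a vertex of the sail of the angle ∠XVY: an integer point of the
angle (other than the vertex) which is a vertex of the convex hull of all
such points. -/
def SailVertex (X V Y P : Pt) : Prop :=
  P ∈ conePts X V Y ∧ toR P ∉ convexHull ℝ (toR '' (conePts X V Y \ {P}))

/-- `B 0, …, B m` is the broken line formed by the vertices of the sail of the
angle ∠XVY, ordered from the edge `VX` to the edge `VY`. -/
def IsSailBL (X V Y : Pt) (m : ℕ) (B : ℕ → Pt) : Prop :=
  (∀ i ≤ m, SailVertex X V Y (B i)) ∧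
  (∀ P, SailVertex X V Y P → ∃ i ≤ m, B i = P) ∧
  (∀ i ≤ m, ∀ j ≤ m, B i = B j → i = j) ∧
  OnRay V X (B 0) ∧ OnRay V Y (B m) ∧
  (∀ i < m, vdet (B (i + 1) - B i) (V - B i) ≠ 0 ∧
    ∀ P, SailVertex X V Y P →
      vdet (B (i + 1) - B i) (V - B i) * vdet (B (i + 1) - B i) (P - B i) ≤ 0)

/-- Sign alternation used in sail diagrams (`1` on the first angle). -/
def sgnAlt (i : ℕ) : ℤ := if i % 2 = 0 then 1 else -1

/-- `D` is the sail diagram of the polygon `A` with the decomposition data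
`m` (numbers of sail edges), `c` (offsets) and `B` (sails of the angles):
the concatenation of the sails of the consecutive angles translated to the
origin, composed with the central symmetry for alternate angles. -/
def IsSailDiagramAux (n : ℕ) (A : ZMod n → Pt) (m c : ℕ → ℕ) (B : ℕ → ℕ → Pt)
    (D : ℕ → Pt) : Prop :=
  c 0 = 0 ∧ (∀ i, c (i + 1) = c i + m i) ∧
  ∀ i < n,
    IsSailBL (A ((i : ZMod n) - 1)) (A (i : ZMod n)) (A ((i : ZMod n) + 1)) (m i) (B i) ∧
    ∀ j ≤ m i, D (c i + j) = sgnAlt i • (B i j - A (i : ZMod n))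

/-- `D 0 … D M` is the sail diagram of the polygon `A`. -/
def IsSailDiagram (n : ℕ) (A : ZMod n → Pt) (M : ℕ) (D : ℕ → Pt) : Prop :=
  ∃ m c B, IsSailDiagramAux n A m c B D ∧ M = c n

/-- `D 0 … D M` is the sail diagram of the broken line `A 0 … A (n+1)`
(whose angles are at the vertices `1,…,n`). -/
def IsSailDiagramBL (n : ℕ) (A : ℕ → Pt) (M : ℕ) (D : ℕ → Pt) : Prop :=
  ∃ (m c : ℕ → ℕ) (B : ℕ → ℕ → Pt),
    c 1 = 0 ∧ (∀ i, c (i + 1) = c i + m i) ∧ M = c (n + 1) ∧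
    ∀ i, 1 ≤ i → i ≤ n →
      IsSailBL (A (i - 1)) (A i) (A (i + 1)) (m i) (B i) ∧
      ∀ j ≤ m i, D (c i + j) = sgnAlt (i + 1) • (B i j - A i)

/-- Euclidean angular measure of the angle between the vectors `u` and `v`. -/
noncomputable def angMeasure (u v : Pt) : ℝ :=
  Real.arccos (((u.1 * v.1 + u.2 * v.2 : ℤ) : ℝ) /
    (Real.sqrt ((u.1 : ℝ) ^ 2 + (u.2 : ℝ) ^ 2) * Real.sqrt ((v.1 : ℝ) ^ 2 + (v.2 : ℝ) ^ 2)))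

/-- Winding number of the broken line `D 0 … D M` about the origin. -/
noncomputable def winding (M : ℕ) (D : ℕ → Pt) : ℝ :=
  (∑ i ∈ Finset.range M, angMeasure (D i) (D (i + 1))) / (2 * Real.pi)

/-- The segment `(b st, b (st+1), …, b (st+len-1))` of a sequence as a list. -/
def bseg (b : ℕ → ℤ) (st len : ℕ) : List ℤ := (List.range len).map fun t => b (st + t)

/-- The edge vertex `Bᵢ` of a normalized sail diagram, via continuants:
`(K(b₁,…,b_{2s}), K(b₀,…,b_{2s}))` where `s = s(i)`. -/
def BiPt (b : ℕ → ℤ) (s : ℕ) : Pt := (cont (bseg b 1 (2 * s)), cont (bseg b 0 (2 * s + 1)))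

/-- The integer point `Bᵢ⁺` following `Bᵢ`:
`(K(b₁,…,b_{2s},b_{2s+1},1), K(b₀,…,b_{2s},b_{2s+1},1))`. -/
def BpPt (b : ℕ → ℤ) (s : ℕ) : Pt :=
  (cont (bseg b 1 (2 * s) ++ [b (2 * s + 1), 1]),
   cont (bseg b 0 (2 * s + 1) ++ [b (2 * s + 1), 1]))

/-- The integer point `Bᵢ⁻` preceding `Bᵢ`:
`(K(b₁,…,b_{2s}−1), K(b₀,…,b_{2s}−1))`. -/
def BmPt (b : ℕ → ℤ) (s : ℕ) : Pt :=
  (cont (bseg b 1 (2 * s - 1) ++ [b (2 * s) - 1]),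
   cont (bseg b 0 (2 * s) ++ [b (2 * s) - 1]))

/-- The point `B̂ᵢ = (K(b₁,…,b_{2s},0,1), K(b₀,…,b_{2s},0,1))`. -/
def hatBPt (b : ℕ → ℤ) (s : ℕ) : Pt :=
  (cont (bseg b 1 (2 * s) ++ [0, 1]), cont (bseg b 0 (2 * s + 1) ++ [0, 1]))

lemma il_dvd (P Q : Pt) : il P Q ∣ Q.1 - P.1 ∧ il P Q ∣ Q.2 - P.2 :=
  ⟨Int.gcd_dvd_left _ _, Int.gcd_dvd_right _ _⟩

lemma il_nonneg (P Q : Pt) : 0 ≤ il P Q := Int.natCast_nonneg _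

lemma il_comm (P Q : Pt) : il P Q = il Q P := by
  unfold il
  rw [← Int.gcd_neg, ← Int.neg_gcd]
  congr 2 <;> ring

lemma il_pos (P Q : Pt) (h : P ≠ Q) : 0 < il P Q := by
  rcases (il_nonneg P Q).lt_or_eq with h' | h'
  · exact h'
  · exfalso
    have : Int.gcd (Q.1 - P.1) (Q.2 - P.2) = 0 := by
      unfold il at h'; exact_mod_cast h'.symm
    rw [Int.gcd_eq_zero_iff] at this
    exact h (Prod.ext (by linarith [this.1]) (by linarith [this.2]))

/-- primitive decomposition -/
lemma prim_exists (P Q : Pt) (h : P ≠ Q) : ∃ e1 e2 x y : ℤ,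
    Q.1 - P.1 = il P Q * e1 ∧ Q.2 - P.2 = il P Q * e2 ∧ x * e1 + y * e2 = 1 := by
  have hp := il_pos P Q h
  obtain ⟨⟨e1, h1⟩, ⟨e2, h2⟩⟩ := il_dvd P Q
  refine ⟨e1, e2, Int.gcdA (Q.1 - P.1) (Q.2 - P.2), Int.gcdB (Q.1 - P.1) (Q.2 - P.2), h1, h2, ?_⟩
  have hb : il P Q = (Q.1 - P.1) * Int.gcdA (Q.1 - P.1) (Q.2 - P.2)
      + (Q.2 - P.2) * Int.gcdB (Q.1 - P.1) (Q.2 - P.2) := Int.gcd_eq_gcd_ab _ _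
  generalize Int.gcdA (Q.1 - P.1) (Q.2 - P.2) = x at *
  generalize Int.gcdB (Q.1 - P.1) (Q.2 - P.2) = y at *
  rw [h1, h2] at hb
  apply mul_left_cancel₀ hp.ne'
  linarith

lemma il_scale (V X Q : Pt) (s t : ℤ) (hs : 0 < s) (ht : 0 < t)
    (h : s • (Q - V) = t • (X - V)) : s * il V Q = t * il V X := by
  simp only [Prod.ext_iff, Prod.smul_fst, Prod.smul_snd, smul_eq_mul, Prod.fst_sub, Prod.snd_sub] at h
  unfold il
  have e1 : s * (Int.gcd (Q.1 - V.1) (Q.2 - V.2) : ℤ)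
      = Int.gcd (s * (Q.1 - V.1)) (s * (Q.2 - V.2)) := by
    rw [Int.gcd_mul_left]; push_cast; rw [abs_of_pos hs]
  have e2 : t * (Int.gcd (X.1 - V.1) (X.2 - V.2) : ℤ)
      = Int.gcd (t * (X.1 - V.1)) (t * (X.2 - V.2)) := by
    rw [Int.gcd_mul_left]; push_cast; rw [abs_of_pos ht]
  rw [e1, e2, h.1, h.2]

lemma ray_eq (V X Q : Pt) (h : OnRay V X Q) (hl : il V Q = il V X) : Q = X := by
  obtain ⟨s, t, hs, ht, h⟩ := h
  have hg := il_scale V X Q s t hs ht h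
  by_cases hV : V = X
  · subst hV
    by_contra hne
    have h1 := il_pos V Q (fun e => hne e.symm)
    have h2 : il V V = 0 := by simp [il]
    omega
  · have hp := il_pos V X hV
    rw [hl] at hg
    have hst : s = t := mul_right_cancel₀ hp.ne' hg
    subst hst
    simp only [Prod.ext_iff, Prod.smul_fst, Prod.smul_snd, smul_eq_mul, Prod.fst_sub,
      Prod.snd_sub] at h
    have a1 := mul_left_cancel₀ hs.ne' h.1
    have a2 := mul_left_cancel₀ hs.ne' h.2
    exact Prod.ext (by linarith) (by linarith)

lemma idist_eq (P S T : Pt) (h : S ≠ T) : idist P S T * il S T = |vdet (T - S) (P - S)| := by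
  unfold idist
  apply Int.ediv_mul_cancel
  rw [dvd_abs]
  obtain ⟨h1, h2⟩ := il_dvd S T
  exact dvd_sub (Dvd.dvd.mul_right h1 _) (Dvd.dvd.mul_right h2 _)

lemma inAngle_signs (X V Y P : Pt) (h : InAngle X V Y P) :
    0 ≤ vdet (P - V) (Y - V) * vdet (X - V) (Y - V) ∧
    0 ≤ vdet (X - V) (P - V) * vdet (X - V) (Y - V) := by
  obtain ⟨q, s, t, hq, hs, ht, h⟩ := h
  simp only [Prod.ext_iff, Prod.smul_fst, Prod.smul_snd, smul_eq_mul, Prod.fst_sub, Prod.snd_sub,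
    Prod.fst_add, Prod.snd_add] at h
  obtain ⟨h1, h2⟩ := h
  have a : q * vdet (P - V) (Y - V) = s * vdet (X - V) (Y - V) := by
    simp only [vdet, Prod.fst_sub, Prod.snd_sub]
    linear_combination (Y.2 - V.2) * h1 - (Y.1 - V.1) * h2
  have b : q * vdet (X - V) (P - V) = t * vdet (X - V) (Y - V) := by
    simp only [vdet, Prod.fst_sub, Prod.snd_sub]
    linear_combination (X.1 - V.1) * h2 - (X.2 - V.2) * h1
  constructor
  · apply nonneg_of_mul_nonneg_right (a := q) _ hq
    rw [← mul_assoc, a, mul_assoc]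
    exact mul_nonneg hs (mul_self_nonneg _)
  · apply nonneg_of_mul_nonneg_right (a := q) _ hq
    rw [← mul_assoc, b, mul_assoc]
    exact mul_nonneg ht (mul_self_nonneg _)

lemma ne_of_vdet (X V Y : Pt) (h : vdet (X - V) (Y - V) ≠ 0) : V ≠ X ∧ V ≠ Y := by
  constructor
  · rintro rfl; apply h; simp [vdet]
  · rintro rfl; apply h; simp [vdet]

lemma near_vdet (X V Y P : Pt) (h0 : vdet (X - V) (Y - V) ≠ 0) (h : InAngle X V Y P)
    (h1 : idist P V Y = 1) :
    vdet (P - V) (Y - V) = (vdet (X - V) (Y - V)).sign * il V Y := by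
  have hs := (inAngle_signs X V Y P h).1
  obtain ⟨hX, hY⟩ := ne_of_vdet X V Y h0
  have hp := il_pos V Y hY
  have he := idist_eq P V Y hY
  rw [h1, one_mul] at he
  have hc : vdet (Y - V) (P - V) = - vdet (P - V) (Y - V) := by unfold vdet; ring
  rw [hc, abs_neg] at he
  rcases lt_or_gt_of_ne h0 with hn | hn
  · rw [Int.sign_eq_neg_one_of_neg hn]
    have : vdet (P - V) (Y - V) ≤ 0 := by nlinarith
    rw [abs_of_nonpos this] at he; linarith
  · rw [Int.sign_eq_one_of_pos hn]
    have : 0 ≤ vdet (P - V) (Y - V) := by nlinarith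
    rw [abs_of_nonneg this] at he; linarith

lemma dist_vdet (X V Y P : Pt) (h0 : vdet (X - V) (Y - V) ≠ 0) (h : InAngle X V Y P) :
    vdet (X - V) (P - V) = (vdet (X - V) (Y - V)).sign * (idist P X V * il X V) := by
  have hs := (inAngle_signs X V Y P h).2
  obtain ⟨hX, hY⟩ := ne_of_vdet X V Y h0
  rw [idist_eq P X V hX.symm]
  have hc : vdet (V - X) (P - X) = - vdet (X - V) (P - V) := by
    simp only [vdet, Prod.fst_sub, Prod.snd_sub]; ring
  rw [hc, abs_neg]
  rcases lt_or_gt_of_ne h0 with hn | hn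
  · rw [Int.sign_eq_neg_one_of_neg hn]
    have : vdet (X - V) (P - V) ≤ 0 := by nlinarith
    rw [abs_of_nonpos this]; linarith
  · rw [Int.sign_eq_one_of_pos hn]
    have : 0 ≤ vdet (X - V) (P - V) := by nlinarith
    rw [abs_of_nonneg this]; linarith

lemma pt_eq_of_vdet (x y p q : Pt) (h0 : vdet x y ≠ 0) (h1 : vdet p y = vdet q y)
    (h2 : vdet x p = vdet x q) : p = q := by
  unfold vdet at *
  refine Prod.ext ?_ ?_
  · apply mul_left_cancel₀ h0
    linear_combination x.1 * h1 + y.1 * h2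
  · apply mul_left_cancel₀ h0
    linear_combination x.2 * h1 + y.2 * h2

lemma near_unique (X V Y P Q : Pt) (h0 : vdet (X - V) (Y - V) ≠ 0) (hP : IsNearPt X V Y P)
    (hQ : IsNearPt X V Y Q) : P = Q := by
  have hd : idist P X V = idist Q X V :=
    le_antisymm (hP.2.2 Q hQ.1 hQ.2.1) (hQ.2.2 P hP.1 hP.2.1)
  have := pt_eq_of_vdet (X - V) (Y - V) (P - V) (Q - V) h0
    (by rw [near_vdet X V Y P h0 hP.1 hP.2.1, near_vdet X V Y Q h0 hQ.1 hQ.2.1])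
    (by rw [dist_vdet X V Y P h0 hP.1, dist_vdet X V Y Q h0 hQ.1, hd])
  exact sub_left_injective this

lemma idist_nonneg (P S T : Pt) : 0 ≤ idist P S T :=
  Int.ediv_nonneg (abs_nonneg _) (il_nonneg _ _)

lemma near_exists (X V Y : Pt) (h0 : vdet (X - V) (Y - V) ≠ 0) : ∃ P, IsNearPt X V Y P := by
  obtain ⟨hX, hY⟩ := ne_of_vdet X V Y h0
  have hp := il_pos V Y hY
  have hne : ∃ P, InAngle X V Y P ∧ idist P V Y = 1 := by
    obtain ⟨e1, e2, x, y, h1, h2, hb⟩ := prim_exists V Y hY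
    obtain ⟨σ, hσ, hσ2⟩ : ∃ σ : ℤ, 0 < σ * vdet (X - V) (Y - V) ∧ |σ| = 1 := by
      rcases lt_or_gt_of_ne h0 with hn | hn
      · exact ⟨-1, by linarith, by norm_num⟩
      · exact ⟨1, by linarith, by norm_num⟩
    set D := vdet (X - V) (Y - V) with hD
    have hD' : D = il V Y * ((X.1 - V.1) * e2 - (X.2 - V.2) * e1) := by
      rw [hD]; simp only [vdet, Prod.fst_sub, Prod.snd_sub]; rw [h1, h2]; ring
    set δ := (X.1 - V.1) * e2 - (X.2 - V.2) * e1 with hδ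
    -- w = σ (y, -x): vdet(w, e) = σ (y e2 + x e1) = σ
    set c := D * (σ * ((X.1 - V.1) * (-x) - (X.2 - V.2) * y)) with hc
    have hδ0 : δ ≠ 0 := by rintro h; rw [h, mul_zero] at hD'; exact h0 hD'
    have hgδ : 1 ≤ D * δ := by
      have : 0 < δ * δ := mul_self_pos.2 hδ0
      rw [hD']; nlinarith
    set P : Pt := (V.1 + σ * y + |c| * e1, V.2 + σ * (-x) + |c| * e2) with hP
    have k1 : vdet (P - V) (Y - V) = σ * il V Y := by
      simp only [hP, vdet, Prod.fst_sub, Prod.snd_sub]; rw [h1, h2]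
      linear_combination σ * il V Y * hb
    have k2 : D * vdet (X - V) (P - V) = c + |c| * (D * δ) := by
      simp only [hP, hc, hδ, vdet, Prod.fst_sub, Prod.snd_sub]
      ring
    refine ⟨P, ⟨D * D, D * vdet (P - V) (Y - V), D * vdet (X - V) (P - V), mul_self_pos.2 h0, ?_, ?_, ?_⟩, ?_⟩
    · rw [k1]; nlinarith
    · rw [k2]
      have := neg_abs_le c
      have := abs_nonneg c
      nlinarith
    · simp only [hD, Prod.ext_iff, Prod.smul_fst, Prod.smul_snd, smul_eq_mul, Prod.fst_add,
        Prod.snd_add, vdet]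
      constructor <;> ring
    · have := idist_eq P V Y hY
      have hcm : vdet (Y - V) (P - V) = - vdet (P - V) (Y - V) := by unfold vdet; ring
      rw [hcm, abs_neg, k1, abs_mul, hσ2, abs_of_pos hp] at this
      exact mul_right_cancel₀ hp.ne' this
  obtain ⟨P, hP, hmin⟩ := WellFounded.has_min (measure (fun P : Pt => (idist P X V).toNat)).wf
    {P | InAngle X V Y P ∧ idist P V Y = 1} hne
  refine ⟨P, hP.1, hP.2, fun Q hQ hQ1 => ?_⟩
  have h := hmin Q ⟨hQ, hQ1⟩
  change ¬ ((idist Q X V).toNat < (idist P X V).toNat) at h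
  have := idist_nonneg P X V
  have := idist_nonneg Q X V
  omega

/-! ### affine invariance -/

lemma vdet_apply (T : IntAff) (P Q R S : Pt) :
    vdet (T.apply P - T.apply Q) (T.apply R - T.apply S)
      = (T.a * T.d - T.b * T.c) * vdet (P - Q) (R - S) := by
  simp only [vdet, IntAff.apply, Prod.fst_sub, Prod.snd_sub]; ring

lemma abs_det (T : IntAff) : |T.a * T.d - T.b * T.c| = 1 := by
  rcases T.unimod with h | h <;> rw [h] <;> norm_num

lemma det_sq (T : IntAff) : (T.a * T.d - T.b * T.c) * (T.a * T.d - T.b * T.c) = 1 := by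
  rcases T.unimod with h | h <;> rw [h] <;> norm_num

lemma apply_surj (T : IntAff) (Q : Pt) : ∃ P, T.apply P = Q := by
  have h := det_sq T
  refine ⟨((T.a * T.d - T.b * T.c) * (T.d * (Q.1 - T.u) - T.b * (Q.2 - T.v)),
    (T.a * T.d - T.b * T.c) * (T.a * (Q.2 - T.v) - T.c * (Q.1 - T.u))), ?_⟩
  refine Prod.ext ?_ ?_
  · simp only [IntAff.apply]
    linear_combination (Q.1 - T.u) * h
  · simp only [IntAff.apply]
    linear_combination (Q.2 - T.v) * h

lemma il_apply (T : IntAff) (P Q : Pt) : il (T.apply P) (T.apply Q) = il P Q := by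
  have h := det_sq T
  obtain ⟨h1, h2⟩ := il_dvd P Q
  obtain ⟨h3, h4⟩ := il_dvd (T.apply P) (T.apply Q)
  have e1 : (T.apply Q).1 - (T.apply P).1 = T.a * (Q.1 - P.1) + T.b * (Q.2 - P.2) := by
    simp only [IntAff.apply]; ring
  have e2 : (T.apply Q).2 - (T.apply P).2 = T.c * (Q.1 - P.1) + T.d * (Q.2 - P.2) := by
    simp only [IntAff.apply]; ring
  apply Int.dvd_antisymm (il_nonneg _ _) (il_nonneg _ _)
  · apply Int.dvd_coe_gcd
    · have : Q.1 - P.1 = (T.a * T.d - T.b * T.c) * T.d * ((T.apply Q).1 - (T.apply P).1)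
          - (T.a * T.d - T.b * T.c) * T.b * ((T.apply Q).2 - (T.apply P).2) := by
        rw [e1, e2]; linear_combination - (Q.1 - P.1) * h
      rw [this]; exact dvd_sub (Dvd.dvd.mul_left h3 _) (Dvd.dvd.mul_left h4 _)
    · have : Q.2 - P.2 = (T.a * T.d - T.b * T.c) * T.a * ((T.apply Q).2 - (T.apply P).2)
          - (T.a * T.d - T.b * T.c) * T.c * ((T.apply Q).1 - (T.apply P).1) := by
        rw [e1, e2]; linear_combination - (Q.2 - P.2) * h
      rw [this]; exact dvd_sub (Dvd.dvd.mul_left h4 _) (Dvd.dvd.mul_left h3 _)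
  · apply Int.dvd_coe_gcd
    · rw [e1]; exact dvd_add (Dvd.dvd.mul_left h1 _) (Dvd.dvd.mul_left h2 _)
    · rw [e2]; exact dvd_add (Dvd.dvd.mul_left h1 _) (Dvd.dvd.mul_left h2 _)

lemma idist_apply (T : IntAff) (P X Y : Pt) :
    idist (T.apply P) (T.apply X) (T.apply Y) = idist P X Y := by
  unfold idist
  rw [vdet_apply, abs_mul, abs_det, one_mul, il_apply]

lemma lin_inj (T : IntAff) (x y : ℤ) (h1 : T.a * x + T.b * y = 0) (h2 : T.c * x + T.d * y = 0) :
    x = 0 ∧ y = 0 := by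
  have h := det_sq T
  constructor
  · linear_combination (- x) * h + (T.a * T.d - T.b * T.c) * (T.d * h1 - T.b * h2)
  · linear_combination (- y) * h + (T.a * T.d - T.b * T.c) * (T.a * h2 - T.c * h1)

lemma inAngle_apply (T : IntAff) (X V Y P : Pt) :
    InAngle (T.apply X) (T.apply V) (T.apply Y) (T.apply P) ↔ InAngle X V Y P := by
  unfold InAngle
  constructor
  · rintro ⟨q, s, t, hq, hs, ht, h⟩
    refine ⟨q, s, t, hq, hs, ht, ?_⟩
    simp only [Prod.ext_iff, Prod.smul_fst, Prod.smul_snd, smul_eq_mul, Prod.fst_sub, Prod.snd_sub,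
      Prod.fst_add, Prod.snd_add, IntAff.apply] at h ⊢
    obtain ⟨h1, h2⟩ := h
    have := lin_inj T (q * (P.1 - V.1) - (s * (X.1 - V.1) + t * (Y.1 - V.1)))
      (q * (P.2 - V.2) - (s * (X.2 - V.2) + t * (Y.2 - V.2)))
      (by linear_combination h1) (by linear_combination h2)
    exact ⟨by linarith [this.1], by linarith [this.2]⟩
  · rintro ⟨q, s, t, hq, hs, ht, h⟩
    refine ⟨q, s, t, hq, hs, ht, ?_⟩
    simp only [Prod.ext_iff, Prod.smul_fst, Prod.smul_snd, smul_eq_mul, Prod.fst_sub, Prod.snd_sub,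
      Prod.fst_add, Prod.snd_add, IntAff.apply] at h ⊢
    obtain ⟨h1, h2⟩ := h
    constructor
    · linear_combination T.a * h1 + T.b * h2
    · linear_combination T.c * h1 + T.d * h2

lemma near_apply (T : IntAff) (X V Y P : Pt) (h : IsNearPt X V Y P) :
    IsNearPt (T.apply X) (T.apply V) (T.apply Y) (T.apply P) := by
  refine ⟨(inAngle_apply T _ _ _ _).2 h.1, by rw [idist_apply]; exact h.2.1, ?_⟩
  intro Q hQ hQ1
  obtain ⟨Q, rfl⟩ := apply_surj T Q
  rw [idist_apply] at hQ1 ⊢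
  rw [idist_apply]
  exact h.2.2 Q ((inAngle_apply T _ _ _ _).1 hQ) hQ1

lemma sgnDir_apply (T : IntAff) (P Q R S : Pt) :
    sgnDir (T.apply P - T.apply Q) (T.apply R - T.apply S) = sgnDir (P - Q) (R - S) := by
  have e1 : (T.apply R - T.apply S = ((0 : ℤ), (0 : ℤ))) ↔ (R - S = ((0 : ℤ), (0 : ℤ))) := by
    simp only [Prod.ext_iff, Prod.fst_sub, Prod.snd_sub, IntAff.apply]
    constructor
    · rintro ⟨h1, h2⟩
      exact lin_inj T _ _ (by linear_combination h1) (by linear_combination h2)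
    · rintro ⟨h1, h2⟩
      constructor
      · linear_combination T.a * h1 + T.b * h2
      · linear_combination T.c * h1 + T.d * h2
  have e2 : (∃ s t : ℤ, 0 < s ∧ 0 < t ∧ s • (T.apply R - T.apply S) = t • (T.apply P - T.apply Q))
      ↔ (∃ s t : ℤ, 0 < s ∧ 0 < t ∧ s • (R - S) = t • (P - Q)) := by
    refine exists_congr fun s => exists_congr fun t => and_congr_right fun _ =>
      and_congr_right fun _ => ?_
    simp only [Prod.ext_iff, Prod.smul_fst, Prod.smul_snd, smul_eq_mul, Prod.fst_sub, Prod.snd_sub,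
      IntAff.apply]
    constructor
    · rintro ⟨h1, h2⟩
      have := lin_inj T (s * (R.1 - S.1) - t * (P.1 - Q.1)) (s * (R.2 - S.2) - t * (P.2 - Q.2))
        (by linear_combination h1) (by linear_combination h2)
      exact ⟨by linarith [this.1], by linarith [this.2]⟩
    · rintro ⟨h1, h2⟩
      constructor
      · linear_combination T.a * h1 + T.b * h2
      · linear_combination T.c * h1 + T.d * h2
  unfold sgnDir
  refine if_congr e1 rfl ?_
  by_cases h : ∃ s t : ℤ, 0 < s ∧ 0 < t ∧ s • (R - S) = t • (P - Q)
  · rw [if_pos h, if_pos (e2.2 h)]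
  · rw [if_neg h, if_neg (fun h' => h (e2.1 h'))]

lemma curv_apply (T : IntAff) (A B C D : Pt) (k : ℤ) (h : IsChordCurv A B C D k) :
    IsChordCurv (T.apply A) (T.apply B) (T.apply C) (T.apply D) k := by
  obtain ⟨B1, C1, h1, h2, h3⟩ := h
  refine ⟨T.apply B1, T.apply C1, near_apply T _ _ _ _ h1, near_apply T _ _ _ _ h2, ?_⟩
  rw [sgnDir_apply, il_apply, il_apply]; exact h3

lemma curv_exists (A B C D : Pt) (h1 : vdet (A - B) (C - B) ≠ 0) (h2 : vdet (B - C) (D - C) ≠ 0) :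
    ∃ k, IsChordCurv A B C D k := by
  obtain ⟨B1, hB⟩ := near_exists A B C h1
  obtain ⟨C1, hC⟩ := near_exists D C B (by
    have : vdet (D - C) (B - C) = - vdet (B - C) (D - C) := by unfold vdet; ring
    rw [this]; exact neg_ne_zero.2 h2)
  exact ⟨_, B1, C1, hB, hC, rfl⟩

lemma angle_apply (T : IntAff) (X V Y : Pt) :
    AngleCong X V Y (T.apply X) (T.apply V) (T.apply Y) :=
  ⟨T, rfl, ⟨1, 1, one_pos, one_pos, rfl⟩, ⟨1, 1, one_pos, one_pos, rfl⟩⟩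

/-- signed length recovers the vector -/
lemma signed_len (B C B1 C1 : Pt) (hBC : B ≠ C) (h : vdet (C1 - B1) (C - B) = 0) :
    il B C • (C1 - B1) = (sgnDir (C - B) (C1 - B1) * il B1 C1) • (C - B) := by
  have hp := il_pos B C hBC
  obtain ⟨e1, e2, x, y, h1, h2, hb⟩ := prim_exists B C hBC
  have h' : (C1.1 - B1.1) * e2 - (C1.2 - B1.2) * e1 = 0 := by
    simp only [vdet, Prod.fst_sub, Prod.snd_sub] at h
    rw [h1, h2] at h
    apply mul_left_cancel₀ hp.ne'
    linear_combination h
  obtain ⟨m, hm⟩ : ∃ m, m = x * (C1.1 - B1.1) + y * (C1.2 - B1.2) := ⟨_, rfl⟩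
  have m1 : C1.1 - B1.1 = m * e1 := by
    rw [hm]; linear_combination y * h' - (C1.1 - B1.1) * hb
  have m2 : C1.2 - B1.2 = m * e2 := by
    rw [hm]; linear_combination -x * h' - (C1.2 - B1.2) * hb
  have hge : Int.gcd e1 e2 = 1 := by
    rw [← Int.isCoprime_iff_gcd_eq_one]; exact ⟨x, y, hb⟩
  have hil : il B1 C1 = |m| := by
    unfold il
    rw [m1, m2, Int.gcd_mul_left, hge]; simp
  suffices hs : sgnDir (C - B) (C1 - B1) * il B1 C1 = m by
    rw [hs]
    simp only [Prod.ext_iff, Prod.smul_fst, Prod.smul_snd, smul_eq_mul, Prod.fst_sub, Prod.snd_sub]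
    rw [m1, m2, h1, h2]
    constructor <;> ring
  rw [hil]
  unfold sgnDir
  split_ifs with c1 c2
  · simp only [Prod.ext_iff, Prod.fst_sub, Prod.snd_sub] at c1
    rw [zero_mul, hm, c1.1, c1.2]; ring
  · obtain ⟨s, t, hs, ht, hst⟩ := c2
    simp only [Prod.ext_iff, Prod.smul_fst, Prod.smul_snd, smul_eq_mul, Prod.fst_sub,
      Prod.snd_sub] at hst
    rw [m1, m2, h1, h2] at hst
    have : s * m = t * il B C := by
      linear_combination x * hst.1 + y * hst.2 - (s * m - t * il B C) * hb
    have hm0 : 0 < m := by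
      have : 0 < s * m := by rw [this]; positivity
      exact pos_of_mul_pos_right this hs.le
    rw [abs_of_pos hm0, one_mul]
  · have : m ≤ 0 := by
      by_contra hm0
      push Not at hm0
      apply c2
      refine ⟨il B C, m, hp, hm0, ?_⟩
      simp only [Prod.ext_iff, Prod.smul_fst, Prod.smul_snd, smul_eq_mul, Prod.fst_sub,
        Prod.snd_sub]
      rw [m1, m2, h1, h2]
      constructor <;> ring
    rw [abs_of_nonpos this]; ring

lemma near_parallel (A B C D B1 C1 : Pt) (h : 0 < vdet (A - B) (C - B) * vdet (B - C) (D - C))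
    (hB : IsNearPt A B C B1) (hC : IsNearPt D C B C1) : vdet (C1 - B1) (C - B) = 0 := by
  have n1 : vdet (A - B) (C - B) ≠ 0 := by intro h'; rw [h'] at h; simp at h
  have n2 : vdet (B - C) (D - C) ≠ 0 := by intro h'; rw [h'] at h; simp at h
  have e : vdet (D - C) (B - C) = - vdet (B - C) (D - C) := by unfold vdet; ring
  have k1 := near_vdet A B C B1 n1 hB.1 hB.2.1
  have k2 := near_vdet D C B C1 (by rw [e]; exact neg_ne_zero.2 n2) hC.1 hC.2.1
  rw [e, Int.sign_neg, il_comm C B] at k2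
  have hsg : (vdet (A - B) (C - B)).sign = (vdet (B - C) (D - C)).sign := by
    rcases pos_and_pos_or_neg_and_neg_of_mul_pos h with ⟨a, b⟩ | ⟨a, b⟩
    · rw [Int.sign_eq_one_of_pos a, Int.sign_eq_one_of_pos b]
    · rw [Int.sign_eq_neg_one_of_neg a, Int.sign_eq_neg_one_of_neg b]
  rw [hsg] at k1
  simp only [vdet, Prod.fst_sub, Prod.snd_sub] at k1 k2 ⊢
  linear_combination -k1 - k2

lemma agree (T S : IntAff) (B C E D : Pt) (h0 : vdet (E - C) (B - C) ≠ 0)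
    (hB : T.apply B = S.apply B) (hC : T.apply C = S.apply C) (hE : T.apply E = S.apply E) :
    T.apply D = S.apply D := by
  simp only [IntAff.apply, Prod.ext_iff, vdet, Prod.fst_sub, Prod.snd_sub] at *
  obtain ⟨b1, b2⟩ := hB
  obtain ⟨c1, c2⟩ := hC
  obtain ⟨e1, e2⟩ := hE
  have a : T.a = S.a := by
    apply mul_left_cancel₀ h0
    linear_combination (B.2 - C.2) * (e1 - c1) - (E.2 - C.2) * (b1 - c1)
  have b : T.b = S.b := by
    apply mul_left_cancel₀ h0
    linear_combination (E.1 - C.1) * (b1 - c1) - (B.1 - C.1) * (e1 - c1)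
  have c : T.c = S.c := by
    apply mul_left_cancel₀ h0
    linear_combination (B.2 - C.2) * (e2 - c2) - (E.2 - C.2) * (b2 - c2)
  have d : T.d = S.d := by
    apply mul_left_cancel₀ h0
    linear_combination (E.1 - C.1) * (b2 - c2) - (B.1 - C.1) * (e2 - c2)
  rw [a, b] at c1 ⊢
  rw [c, d] at c2 ⊢
  exact ⟨by linarith, by linarith⟩

lemma cong_lengths (X V Y X' V' Y' : Pt) (h : AngleCong X V Y X' V' Y')
    (h1 : il X V = il X' V') (h2 : il V Y = il V' Y') :
    ∃ S : IntAff, S.apply X = X' ∧ S.apply V = V' ∧ S.apply Y = Y' := by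
  obtain ⟨S, hV, hX, hY⟩ := h
  subst hV
  refine ⟨S, ray_eq _ _ _ hX ?_, rfl, ray_eq _ _ _ hY ?_⟩
  · rw [il_apply, il_comm V X, h1, il_comm]
  · rw [il_apply, h2]

lemma step (T : IntAff) (A B C D A' B' C' D' : Pt) (k : ℤ)
    (hA : T.apply A = A') (hB : T.apply B = B') (hC : T.apply C = C')
    (h : 0 < vdet (A - B) (C - B) * vdet (B - C) (D - C))
    (h' : 0 < vdet (A' - B') (C' - B') * vdet (B' - C') (D' - C'))
    (hang : AngleCong B C D B' C' D') (hl : il C D = il C' D')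
    (hk : IsChordCurv A B C D k) (hk' : IsChordCurv A' B' C' D' k) : T.apply D = D' := by
  have hBC : il B C = il B' C' := by rw [← hB, ← hC, il_apply]
  obtain ⟨S, sB, sC, sD⟩ := cong_lengths _ _ _ _ _ _ hang hBC hl
  obtain ⟨B1, C1, nB, nC, e⟩ := hk
  obtain ⟨B2, C2, nB', nC', e'⟩ := hk'
  have n1 : vdet (A - B) (C - B) ≠ 0 := by intro h2; rw [h2] at h; simp at h
  have n1' : vdet (A' - B') (C' - B') ≠ 0 := by intro h2; rw [h2] at h'; simp at h'
  have n2 : vdet (B - C) (D - C) ≠ 0 := by intro h2; rw [h2] at h; simp at h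
  have n2' : vdet (B' - C') (D' - C') ≠ 0 := by intro h2; rw [h2] at h'; simp at h'
  have ec : vdet (D - C) (B - C) = - vdet (B - C) (D - C) := by unfold vdet; ring
  have ec' : vdet (D' - C') (B' - C') = - vdet (B' - C') (D' - C') := by unfold vdet; ring
  have m2 : vdet (D - C) (B - C) ≠ 0 := by rw [ec]; exact neg_ne_zero.2 n2
  have m2' : vdet (D' - C') (B' - C') ≠ 0 := by rw [ec']; exact neg_ne_zero.2 n2'
  have p1 := near_apply T _ _ _ _ nB
  rw [hA, hB, hC] at p1
  have p2 := near_apply S _ _ _ _ nC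
  rw [sB, sC, sD] at p2
  obtain rfl := near_unique _ _ _ _ _ n1' p1 nB'
  obtain rfl := near_unique _ _ _ _ _ m2' p2 nC'
  have hne := (ne_of_vdet _ _ _ n1).2
  have hne' := (ne_of_vdet _ _ _ n1').2
  have l1 := signed_len B C B1 C1 hne (near_parallel A B C D B1 C1 h nB nC)
  have l2 := signed_len B' C' _ _ hne' (near_parallel A' B' C' D' _ _ h' nB' nC')
  have f : sgnDir (C' - B') (S.apply C1 - T.apply B1) * il (T.apply B1) (S.apply C1)
      = sgnDir (C - B) (C1 - B1) * il B1 C1 := by linarith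
  rw [f, ← hBC, ← hB, ← hC] at l2
  generalize sgnDir (C - B) (C1 - B1) * il B1 C1 = m at *
  have hp := il_pos B C hne
  have hTS : T.apply C1 = S.apply C1 := by
    simp only [IntAff.apply, Prod.ext_iff, Prod.smul_fst, Prod.smul_snd, smul_eq_mul, Prod.fst_sub,
      Prod.snd_sub] at l1 l2 ⊢
    obtain ⟨a1, a2⟩ := l1
    obtain ⟨b1, b2⟩ := l2
    constructor
    · apply mul_left_cancel₀ hp.ne'
      linear_combination T.a * a1 + T.b * a2 - b1
    · apply mul_left_cancel₀ hp.ne'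
      linear_combination T.c * a1 + T.d * a2 - b2
  have hn : vdet (C1 - C) (B - C) ≠ 0 := by
    rw [near_vdet D C B C1 m2 nC.1 nC.2.1, il_comm]
    exact mul_ne_zero (by rw [Ne, Int.sign_eq_zero_iff_zero]; exact m2) hp.ne'
  rw [← sD]
  exact agree T S B C C1 D hn (hB.trans sB.symm) (hC.trans sC.symm) hTS

lemma bl_back (n : ℕ) (A A' : ℕ → Pt) (hn : 1 ≤ n)
    (hA : LocallyConvexBL n A) (hA' : LocallyConvexBL n A')
    (h1 : ∀ i, 1 ≤ i → i ≤ n →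
      AngleCong (A (i - 1)) (A i) (A (i + 1)) (A' (i - 1)) (A' i) (A' (i + 1)))
    (h2 : ∀ i, 1 ≤ i → i ≤ n - 1 → ∃ k : ℤ,
      IsChordCurv (A (i - 1)) (A i) (A (i + 1)) (A (i + 2)) k ∧
      IsChordCurv (A' (i - 1)) (A' i) (A' (i + 1)) (A' (i + 2)) k)
    (h3 : ∀ i ≤ n, il (A i) (A (i + 1)) = il (A' i) (A' (i + 1))) :
    ∃ T : IntAff, ∀ i ≤ n + 1, T.apply (A i) = A' i := by
  have prod : ∀ A : ℕ → Pt, LocallyConvexBL n A → ∀ j, j + 2 ≤ n →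
      0 < vdet (A j - A (j + 1)) (A (j + 2) - A (j + 1)) *
        vdet (A (j + 1) - A (j + 2)) (A (j + 3) - A (j + 2)) := by
    intro A hA j hj
    rcases hA with h | h
    · exact mul_pos (h (j + 1) (by omega) (by omega)) (h (j + 2) (by omega) (by omega))
    · exact mul_pos_of_neg_of_neg (h (j + 1) (by omega) (by omega)) (h (j + 2) (by omega) (by omega))
  obtain ⟨T, t0, t1, t2⟩ := cong_lengths _ _ _ _ _ _ (h1 1 le_rfl hn) (h3 0 (by omega)) (h3 1 hn)
  refine ⟨T, ?_⟩
  have key : ∀ j, j + 1 ≤ n → T.apply (A j) = A' j ∧ T.apply (A (j + 1)) = A' (j + 1) ∧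
      T.apply (A (j + 2)) = A' (j + 2) := by
    intro j
    induction j with
    | zero => intro _; exact ⟨t0, t1, t2⟩
    | succ j ih =>
      intro hj
      obtain ⟨q0, q1, q2⟩ := ih (by omega)
      refine ⟨q1, q2, ?_⟩
      obtain ⟨k, k1, k2⟩ := h2 (j + 1) (by omega) (by omega)
      exact step T (A j) (A (j + 1)) (A (j + 2)) (A (j + 3)) _ _ _ _ k q0 q1 q2
        (prod A hA j (by omega)) (prod A' hA' j (by omega))
        (h1 (j + 2) (by omega) (by omega)) (h3 (j + 2) (by omega)) k1 k2
  intro i hi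
  rcases Nat.lt_or_ge i n with h | h
  · exact (key i (by omega)).1
  · obtain ⟨m, rfl⟩ : ∃ m, n = m + 1 := ⟨n - 1, by omega⟩
    have := key m le_rfl
    rcases Nat.eq_or_lt_of_le h with h | h
    · rw [← h]; exact this.2.1
    · have : i = m + 2 := by omega
      subst this; tauto

lemma poly_vdet (n : ℕ) (A : ZMod n → Pt) (hn : 3 ≤ n) (hA : ConvexPolygon n A) (i : ZMod n) :
    0 < vdet (A (i - 1) - A i) (A (i + 1) - A i) := by
  have h1 : (1 : ZMod n) ≠ 0 := by
    have : ((1 : ℕ) : ZMod n) ≠ 0 := by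
      rw [Ne, ZMod.natCast_eq_zero_iff]
      intro h; have := Nat.le_of_dvd (by omega) h; omega
    simpa using this
  have h2 : (2 : ZMod n) ≠ 0 := by
    have : ((2 : ℕ) : ZMod n) ≠ 0 := by
      rw [Ne, ZMod.natCast_eq_zero_iff]
      intro h; have := Nat.le_of_dvd (by omega) h; omega
    simpa using this
  have := hA i (i - 1) (by intro h; apply h1; linear_combination -h)
    (by intro h; apply h2; linear_combination -h)
  have e : vdet (A (i - 1) - A i) (A (i + 1) - A i) = - vdet (A (i + 1) - A i) (A (i - 1) - A i) := by
    unfold vdet; ring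
  rw [e]; linarith

lemma poly_bl (n : ℕ) (A : ZMod n → Pt) (hn : 3 ≤ n) (hA : ConvexPolygon n A) :
    LocallyConvexBL n (fun i : ℕ => A (i : ZMod n)) := by
  left
  intro i hi _
  have := poly_vdet n A hn hA (i : ZMod n)
  simp only [Nat.cast_sub hi, Nat.cast_add, Nat.cast_one]
  exact this

/-- **Proposition.** Two locally convex broken lines (respectively, two convex
polygons) with integer vertices are integer congruent if and only if their
angle-curvature sequences coincide (corresponding angles are integer congruent
and corresponding chord curvatures are equal) and their sequences of integer
lengths of edges coincide. -/
theorem cong_iff_angle_curvature_lengths :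
    (∀ (n : ℕ) (A A' : ℕ → Pt), 1 ≤ n →
      LocallyConvexBL n A → LocallyConvexBL n A' →
      ((∃ T : IntAff, ∀ i ≤ n + 1, T.apply (A i) = A' i) ↔
        ((∀ i, 1 ≤ i → i ≤ n →
            AngleCong (A (i - 1)) (A i) (A (i + 1)) (A' (i - 1)) (A' i) (A' (i + 1))) ∧
         (∀ i, 1 ≤ i → i ≤ n - 1 → ∃ k : ℤ,
            IsChordCurv (A (i - 1)) (A i) (A (i + 1)) (A (i + 2)) k ∧
            IsChordCurv (A' (i - 1)) (A' i) (A' (i + 1)) (A' (i + 2)) k) ∧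
         (∀ i ≤ n, il (A i) (A (i + 1)) = il (A' i) (A' (i + 1)))))) ∧
    (∀ (n : ℕ) (A A' : ZMod n → Pt), 3 ≤ n →
      ConvexPolygon n A → ConvexPolygon n A' →
      ((∃ T : IntAff, ∀ i, T.apply (A i) = A' i) ↔
        (∀ i : ZMod n,
          AngleCong (A (i - 1)) (A i) (A (i + 1)) (A' (i - 1)) (A' i) (A' (i + 1)) ∧
          (∃ k : ℤ,
            IsChordCurv (A (i - 1)) (A i) (A (i + 1)) (A (i + 2)) k ∧
            IsChordCurv (A' (i - 1)) (A' i) (A' (i + 1)) (A' (i + 2)) k) ∧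
          il (A i) (A (i + 1)) = il (A' i) (A' (i + 1))))) := by
  refine ⟨?_, ?_⟩
  · intro n A A' hn hA hA'
    constructor
    · rintro ⟨T, hT⟩
      have nz : ∀ i, 1 ≤ i → i ≤ n → vdet (A (i - 1) - A i) (A (i + 1) - A i) ≠ 0 := by
        intro i h1 h2
        rcases hA with h | h
        · exact (h i h1 h2).ne'
        · exact (h i h1 h2).ne
      refine ⟨fun i h1 h2 => ?_, fun i h1 h2 => ?_, fun i h1 => ?_⟩
      · rw [← hT (i - 1) (by omega), ← hT i (by omega), ← hT (i + 1) (by omega)]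
        exact angle_apply T _ _ _
      · obtain ⟨k, hk⟩ := curv_exists (A (i - 1)) (A i) (A (i + 1)) (A (i + 2))
          (nz i h1 (by omega)) (nz (i + 1) (by omega) (by omega))
        refine ⟨k, hk, ?_⟩
        rw [← hT (i - 1) (by omega), ← hT i (by omega), ← hT (i + 1) (by omega),
          ← hT (i + 2) (by omega)]
        exact curv_apply T _ _ _ _ _ hk
      · rw [← hT i (by omega), ← hT (i + 1) (by omega), il_apply]
    · rintro ⟨h1, h2, h3⟩
      exact bl_back n A A' hn hA hA' h1 h2 h3
  · intro n A A' hn hA hA'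
    haveI : NeZero n := ⟨by omega⟩
    constructor
    · rintro ⟨T, hT⟩ i
      refine ⟨?_, ?_, ?_⟩
      · rw [← hT, ← hT, ← hT]; exact angle_apply T _ _ _
      · have n2 := poly_vdet n A hn hA (i + 1)
        rw [add_sub_cancel_right, add_assoc, one_add_one_eq_two] at n2
        obtain ⟨k, hk⟩ := curv_exists (A (i - 1)) (A i) (A (i + 1)) (A (i + 2))
          (poly_vdet n A hn hA i).ne' n2.ne'
        refine ⟨k, hk, ?_⟩
        rw [← hT, ← hT, ← hT, ← hT]
        exact curv_apply T _ _ _ _ _ hk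
      · rw [← hT, ← hT, il_apply]
    · intro h
      obtain ⟨T, hT⟩ := bl_back n (fun i : ℕ => A (i : ZMod n)) (fun i : ℕ => A' (i : ZMod n))
        (by omega) (poly_bl n A hn hA) (poly_bl n A' hn hA')
        (by
          intro i hi _
          simp only [Nat.cast_sub hi, Nat.cast_add, Nat.cast_one]
          exact (h i).1)
        (by
          intro i hi _
          simp only [Nat.cast_sub hi, Nat.cast_add, Nat.cast_one, Nat.cast_ofNat]
          exact (h i).2.1)
        (by
          intro i _
          simp only [Nat.cast_add, Nat.cast_one]
          exact (h i).2.2)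
      refine ⟨T, fun i => ?_⟩
      have := hT i.val (by have := ZMod.val_lt i; omega)
      simpa using this
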